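/- Let 𝒜 ∈ ℝ^{n×n}, ℬ ∈ ℝ^{n×p}, 𝒞 ∈ ℝ^{p×n} with 𝒞ℬ = 0 and det(𝒞𝒜ℬ) ≠ 0 (relative degree two). Let 𝒞_z ∈ ℝ^{(n−2p)×n} satisfy 𝒞_zℬ = 0 with T = [𝒞_z; 𝒞; 𝒞𝒜] invertible, and let A11 ∈ ℝ^{(n−2p)×(n−2p)} be the top-left block of T𝒜T^{−1} (the zero dynamics matrix). Assume det(A11) ≠ 0 (the system has no zero at the origin). Then the following are equivalent: (i) there exist K_x ∈ ℝ^{p×n} and an invertible K_v ∈ ℝ^{p×p} such that the closed-loop realization (𝒜 + ℬK_x, ℬK_v, 𝒞) is controllable and observable, det(𝒜 + ℬK_x) ≠ 0, and there exists a real symmetric positive definite Y ∈ ℝ^{n×n} with (𝒜 + ℬK_x)Y + Y(𝒜 + ℬK_x)ᵀ negative semidefinite and ℬK_v + (𝒜 + ℬK_x)Y𝒞ᵀ = 0; (ii) the pair (𝒜, ℬ) is controllable and A11 is Lyapunov stable (the system is weakly minimum phase). -/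

import Mathlib

open Matrix

/-- PBH eigenvector test for controllability of a pair of real matrices `(M, N)`:
no eigenvector of `Mᵀ` (over `ℂ`) lies in the kernel of `Nᵀ`. -/
def IsControllablePair {k q : Type*} [Fintype k] [Fintype q]
    (M : Matrix k k ℝ) (N : Matrix k q ℝ) : Prop :=
  ∀ (μ : ℂ) (v : k → ℂ), v ≠ 0 →
    (M.map Complex.ofReal)ᵀ *ᵥ v = μ • v → (N.map Complex.ofReal)ᵀ *ᵥ v ≠ 0

/-- Eigenvector test for observability of a pair of real matrices `(M, L)`:
no eigenvector of `M` (over `ℂ`) lies in the kernel of `L`. -/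
def IsObservablePair {k q : Type*} [Fintype k] [Fintype q]
    (M : Matrix k k ℝ) (L : Matrix q k ℝ) : Prop :=
  ∀ (μ : ℂ) (v : k → ℂ), v ≠ 0 →
    (M.map Complex.ofReal) *ᵥ v = μ • v → (L.map Complex.ofReal) *ᵥ v ≠ 0

/-- A real square matrix is Lyapunov stable if every eigenvalue (over `ℂ`) has nonpositive
real part and every purely imaginary eigenvalue is semisimple
(`ker (M - μI)² = ker (M - μI)`). -/
def IsLyapunovStable {k : Type*} [Fintype k] [DecidableEq k] (M : Matrix k k ℝ) : Prop :=
  ∀ μ : ℂ, (∃ v : k → ℂ, v ≠ 0 ∧ (M.map Complex.ofReal) *ᵥ v = μ • v) →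
    μ.re ≤ 0 ∧ (μ.re = 0 →
      ∀ v : k → ℂ,
        (M.map Complex.ofReal - μ • 1) *ᵥ ((M.map Complex.ofReal - μ • 1) *ᵥ v) = 0 →
        (M.map Complex.ofReal - μ • 1) *ᵥ v = 0)

open Polynomial in
/-- A real polynomial with roots in the closed left half plane splits into a factor with roots in
the open left half plane and a factor with purely imaginary roots. -/
theorem exists_factor_re_neg_re_zero (q : ℝ[X]) (hq : q ≠ 0)
    (h : ∀ z : ℂ, aeval z q = 0 → z.re ≤ 0) :
    ∃ f g : ℝ[X], q = f * g ∧ (∀ z : ℂ, aeval z f = 0 → z.re < 0) ∧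
      (∀ z : ℂ, aeval z g = 0 → z.re = 0) := by
  have no_root : ∀ u : ℝ[X], IsUnit u → ∀ z : ℂ, aeval z u ≠ 0 := fun u hu z =>
    (hu.map (aeval z)).ne_zero
  induction q using WfDvdMonoid.induction_on_irreducible with
  | zero => exact absurd rfl hq
  | unit u hu =>
    exact ⟨u, 1, by simp, fun z hz => absurd hz (no_root u hu z), fun z hz => by simp at hz⟩
  | mul a i ha hi ih =>
    obtain ⟨f, g, rfl, hf, hg⟩ := ih ha fun z hz => h z (by simp [hz])
    have hi_re : ∀ z : ℂ, aeval z i = 0 → z.re ≤ 0 := fun z hz => h z (by simp [hz])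
    by_cases hex : ∃ z : ℂ, aeval z i = 0 ∧ z.re = 0
    · obtain ⟨z, hz, hz0⟩ := hex
      have hdvd : i ∣ i.comp (-X) := by
        have h1 : minpoly ℝ z ∣ i := minpoly.dvd ℝ z hz
        have h2 : minpoly ℝ z ∣ i.comp (-X) := by
          refine minpoly.dvd ℝ z ?_
          have hc : -z = (starRingEnd ℂ) z := by
            apply Complex.ext <;> simp [hz0]
          rw [aeval_comp]
          simp only [map_neg, aeval_X]
          rw [hc, Polynomial.aeval_conj, hz, map_zero]
        have hzint : IsIntegral ℝ z := ⟨_, minpoly.monic (Algebra.IsIntegral.isIntegral z),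
          minpoly.aeval ℝ z⟩
        exact ((minpoly.irreducible hzint).dvd_symm hi h1).trans h2
      refine ⟨f, i * g, by ring, hf, fun w hw => ?_⟩
      rw [map_mul, mul_eq_zero] at hw
      rcases hw with hw | hw
      · have h1 := hi_re w hw
        have h2 : aeval (-w) i = 0 := by
          obtain ⟨c, hc⟩ := hdvd
          have := congrArg (aeval w) hc
          rw [aeval_comp] at this
          simpa [hw] using this
        have h3 := hi_re _ h2
        simp at h3
        linarith
      · exact hg w hw
    · refine ⟨i * f, g, by ring, fun w hw => ?_, hg⟩
      rw [map_mul, mul_eq_zero] at hw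
      rcases hw with hw | hw
      · exact lt_of_le_of_ne (hi_re w hw) fun h0 => hex ⟨w, hw, h0⟩
      · exact hf w hw

section Complexification

variable {k l q : Type*}

theorem map_ofReal_mul [Fintype l] (M : Matrix k l ℝ) (N : Matrix l q ℝ) :
    (M * N).map Complex.ofReal = M.map Complex.ofReal * N.map Complex.ofReal :=
  Matrix.map_mul (f := Complex.ofRealHom)

theorem map_ofReal_add (M N : Matrix k l ℝ) :
    (M + N).map Complex.ofReal = M.map Complex.ofReal + N.map Complex.ofReal :=
  Matrix.map_add _ Complex.ofReal_add M N

theorem map_ofReal_sub (M N : Matrix k l ℝ) :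
    (M - N).map Complex.ofReal = M.map Complex.ofReal - N.map Complex.ofReal :=
  Matrix.map_sub _ Complex.ofReal_sub M N

theorem map_ofReal_neg (M : Matrix k l ℝ) :
    (-M).map Complex.ofReal = -M.map Complex.ofReal := by
  ext; simp

theorem map_ofReal_zero : (0 : Matrix k l ℝ).map Complex.ofReal = 0 := by
  ext; simp

theorem map_ofReal_one [DecidableEq k] : (1 : Matrix k k ℝ).map Complex.ofReal = 1 :=
  Matrix.map_one _ Complex.ofReal_zero Complex.ofReal_one

theorem map_ofReal_transpose (M : Matrix k l ℝ) :
    Mᵀ.map Complex.ofReal = (M.map Complex.ofReal)ᵀ := rfl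

theorem conjTranspose_map_ofReal (M : Matrix k l ℝ) :
    (M.map Complex.ofReal)ᴴ = (M.map Complex.ofReal)ᵀ := by
  ext; simp

open scoped ComplexOrder MatrixOrder in
theorem posSemidef_map_ofReal [Fintype k] {M : Matrix k k ℝ} (hM : M.PosSemidef) :
    (M.map Complex.ofReal).PosSemidef := by
  classical
  obtain ⟨B, rfl⟩ := (CStarAlgebra.nonneg_iff_eq_star_mul_self (a := M)).mp hM.nonneg
  have : (star B * B).map Complex.ofReal = (B.map Complex.ofReal)ᴴ * B.map Complex.ofReal := by
    rw [map_ofReal_mul, conjTranspose_map_ofReal, star_eq_conjTranspose,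
      conjTranspose_eq_transpose_of_trivial, map_ofReal_transpose]
  rw [this]
  exact posSemidef_conjTranspose_mul_self _

theorem map_ofReal_mulVec_injective [Fintype k] [DecidableEq k] {M : Matrix k k ℝ}
    (hM : IsUnit M) {v : k → ℂ} (hv : M.map Complex.ofReal *ᵥ v = 0) : v = 0 := by
  obtain ⟨N, hN⟩ := hM.exists_left_inv
  have := congrArg (N.map Complex.ofReal *ᵥ ·) hv
  simpa [mulVec_mulVec, ← map_ofReal_mul, hN, map_ofReal_one] using this

theorem isUnit_of_map_ofReal_mulVec_injective [Fintype k] [DecidableEq k] {M : Matrix k k ℝ}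
    (hM : ∀ v : k → ℂ, M.map Complex.ofReal *ᵥ v = 0 → v = 0) : IsUnit M := by
  rw [Matrix.isUnit_iff_isUnit_det, isUnit_iff_ne_zero]
  intro h0
  obtain ⟨v, hv, hv0⟩ := Matrix.exists_mulVec_eq_zero_iff.mpr h0
  refine hv (funext fun i => ?_)
  have h1 := hM (fun i => (v i : ℂ)) (by
    ext i
    have := congrArg Complex.ofReal (congrFun hv0 i)
    simpa [mulVec, dotProduct] using this)
  simpa using congrFun h1 i

open scoped ComplexOrder in
theorem posDef_map_ofReal [Fintype k] {M : Matrix k k ℝ} (hM : M.PosDef) :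
    (M.map Complex.ofReal).PosDef := by
  classical
  exact (posSemidef_map_ofReal hM.posSemidef).posDef_iff_isUnit.mpr
    (hM.isUnit.map Complex.ofRealHom.mapMatrix)

theorem map_ofReal_mul_mulVec [Fintype l] [Fintype q] (M : Matrix k l ℝ) (N : Matrix l q ℝ)
    (v : q → ℂ) :
    (M * N).map Complex.ofReal *ᵥ v = M.map Complex.ofReal *ᵥ (N.map Complex.ofReal *ᵥ v) := by
  rw [map_ofReal_mul, mulVec_mulVec]

theorem map_ofReal_aeval_mulVec [Fintype k] [DecidableEq k] {A : Matrix k k ℝ} {μ : ℂ} {v : k → ℂ}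
    (hv : A.map Complex.ofReal *ᵥ v = μ • v) (f : Polynomial ℝ) :
    (Polynomial.aeval A f).map Complex.ofReal *ᵥ v = Polynomial.aeval μ f • v := by
  have hpow : ∀ j : ℕ, (A ^ j).map Complex.ofReal *ᵥ v = μ ^ j • v := by
    intro j
    induction j with
    | zero => simp
    | succ j ih => rw [pow_succ, map_ofReal_mul, ← mulVec_mulVec, hv, mulVec_smul, ih, smul_smul,
        pow_succ']
  induction f using Polynomial.induction_on' with
  | add f g hf hg => rw [map_add, map_ofReal_add, add_mulVec, hf, hg, map_add, add_smul]
  | monomial j a =>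
    have : (a • A ^ j).map Complex.ofReal = (a : ℂ) • (A ^ j).map Complex.ofReal := by
      ext; simp
    rw [Polynomial.aeval_monomial, Polynomial.aeval_monomial, ← Algebra.smul_def, this,
      smul_mulVec, hpow, smul_smul]
    rfl

theorem exists_eigenvector_of_aeval_charpoly [Fintype k] [DecidableEq k] {A : Matrix k k ℝ} {μ : ℂ}
    (h : Polynomial.aeval μ A.charpoly = 0) :
    ∃ v : k → ℂ, v ≠ 0 ∧ A.map Complex.ofReal *ᵥ v = μ • v := by
  have h1 : (A.map Complex.ofReal).charpoly.eval μ = 0 := by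
    have := Matrix.charpoly_map A Complex.ofRealHom
    rw [Polynomial.aeval_def, ← Polynomial.eval_map] at h
    exact (congrArg (Polynomial.eval μ) this).trans h
  rw [Matrix.eval_charpoly] at h1
  obtain ⟨v, hv, hv0⟩ := Matrix.exists_mulVec_eq_zero_iff.mpr h1
  refine ⟨v, hv, ?_⟩
  rw [sub_mulVec, sub_eq_zero] at hv0
  rw [← hv0]
  simp

end Complexification

/-- The real spectral projection of a Lyapunov stable matrix onto its asymptotically stable
part. -/
theorem exists_stable_projection {k : Type*} [Fintype k] [DecidableEq k] {A : Matrix k k ℝ}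
    (hA : IsLyapunovStable A) :
    ∃ P : Matrix k k ℝ, A * P = P * A ∧ P * P = P ∧
      (∀ (μ : ℂ) (v : k → ℂ), A.map Complex.ofReal *ᵥ v = μ • v → μ.re = 0 →
        P.map Complex.ofReal *ᵥ v = 0) ∧
      (∀ (μ : ℂ) (v : k → ℂ), A.map Complex.ofReal *ᵥ v = μ • v → μ.re < 0 →
        P.map Complex.ofReal *ᵥ v = v) := by
  obtain ⟨f, g, hfg, hf, hg⟩ := exists_factor_re_neg_re_zero A.charpoly
    A.charpoly_monic.ne_zero fun z hz => (hA z (exists_eigenvector_of_aeval_charpoly hz)).1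
  have hcop : IsCoprime f g := by
    rw [Polynomial.isCoprime_iff_aeval_ne_zero_of_isAlgClosed ℝ ℂ]
    intro z
    by_contra! hz
    exact absurd (hg z hz.2) (hf z hz.1).ne
  obtain ⟨a, b, hab⟩ := hcop
  have hzero : Polynomial.aeval A (f * g) = 0 := hfg ▸ A.aeval_self_charpoly
  refine ⟨Polynomial.aeval A (b * g), ?_, ?_, ?_, ?_⟩
  · have := congrArg (Polynomial.aeval A) (mul_comm Polynomial.X (b * g))
    simpa only [map_mul _ Polynomial.X, map_mul _ _ Polynomial.X, Polynomial.aeval_X] using this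
  · have h1 : b * g * (b * g) = b * g - a * b * (f * g) := by
      linear_combination (b * g) * hab
    rw [← map_mul, h1, map_sub, map_mul _ (a * b), hzero, mul_zero, sub_zero]
  · intro μ v hv hμ
    rw [map_ofReal_aeval_mulVec hv]
    have h1 := map_ofReal_aeval_mulVec hv (f * g)
    rw [hzero, map_ofReal_zero, zero_mulVec, map_mul] at h1
    rcases smul_eq_zero.mp h1.symm with h2 | h2
    · rcases mul_eq_zero.mp h2 with h3 | h3
      · exact absurd hμ (hf μ h3).ne
      · simp [h3]
    · simp [h2]
  · intro μ v hv hμ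
    rw [map_ofReal_aeval_mulVec hv]
    have h1 := map_ofReal_aeval_mulVec hv (f * g)
    rw [hzero, map_ofReal_zero, zero_mulVec, map_mul] at h1
    rcases smul_eq_zero.mp h1.symm with h2 | h2
    · rcases mul_eq_zero.mp h2 with h3 | h3
      · have h4 := congrArg (Polynomial.aeval μ) hab
        simp only [map_add, map_mul, h3, mul_zero, zero_add, map_one] at h4
        rw [map_mul, h4, one_smul]
      · exact absurd (hg μ h3) hμ.ne
    · simp [h2]

section DiscreteLyapunov

attribute [local instance] Matrix.linftyOpNormedRing Matrix.linftyOpNormedAlgebra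

open Filter Topology in
/-- A complex matrix whose eigenvalues lie in the open unit disc has geometrically decaying
powers. -/
theorem exists_eventually_norm_pow_le {k : Type*} [Fintype k] [DecidableEq k] [Nonempty k]
    (M : Matrix k k ℂ) (hM : ∀ (μ : ℂ) (v : k → ℂ), v ≠ 0 → M *ᵥ v = μ • v → ‖μ‖ < 1) :
    ∃ r : ℝ, 0 ≤ r ∧ r < 1 ∧ ∀ᶠ j in atTop, ‖M ^ j‖ ≤ r ^ j := by
  have hlt : spectralRadius ℂ M < (1 : NNReal) := by
    refine spectrum.spectralRadius_lt_of_forall_lt M fun μ hμ => ?_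
    rw [← Matrix.spectrum_toLin', ← Module.End.hasEigenvalue_iff_mem_spectrum] at hμ
    obtain ⟨v, hv⟩ := hμ.exists_hasEigenvector
    have := hM μ v hv.2 (by simpa using hv.apply_eq_smul)
    exact_mod_cast this
  obtain ⟨r, hr1, hr2⟩ := ENNReal.lt_iff_exists_nnreal_btwn.mp hlt
  refine ⟨r, r.2, by exact_mod_cast hr2, ?_⟩
  have hev := (spectrum.pow_nnnorm_pow_one_div_tendsto_nhds_spectralRadius M).eventually_lt_const
    hr1
  filter_upwards [hev, eventually_gt_atTop 0] with j hj hj0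
  have h1 : (‖M ^ j‖₊ : ENNReal) ≤ (r : ENNReal) ^ j := by
    have h2 := ENNReal.rpow_le_rpow hj.le (Nat.cast_nonneg (α := ℝ) j)
    rwa [← ENNReal.rpow_mul, one_div, inv_mul_cancel₀ (by positivity), ENNReal.rpow_one,
      ENNReal.rpow_natCast] at h2
  exact_mod_cast h1

/-- The discrete Lyapunov (Stein) equation has a positive semidefinite solution. -/
theorem exists_posSemidef_stein_solution {k : Type*} [Fintype k] [DecidableEq k]
    (M R : Matrix k k ℝ)
    (hM : ∀ (μ : ℂ) (v : k → ℂ), v ≠ 0 → M.map Complex.ofReal *ᵥ v = μ • v → ‖μ‖ < 1)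
    (hR : R.PosSemidef) :
    ∃ S : Matrix k k ℝ, S.PosSemidef ∧ S = R + M * S * Mᵀ := by
  rcases isEmpty_or_nonempty k with hk | hk
  · exact ⟨0, .zero, Subsingleton.elim _ _⟩
  obtain ⟨r, hr0, hr1, hev⟩ := exists_eventually_norm_pow_le _ hM
  have hentry : ∀ (N : Matrix k k ℂ) i j, ‖N i j‖ ≤ ‖N‖ := fun N i j => by
    rw [Matrix.linfty_opNorm_def]
    have h1 : ‖N i j‖₊ ≤ ∑ j, ‖N i j‖₊ :=
      Finset.single_le_sum (f := fun j => ‖N i j‖₊) (fun _ _ => zero_le) (Finset.mem_univ j)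
    have h2 : ∑ j, ‖N i j‖₊ ≤ Finset.univ.sup fun i => ∑ j, ‖N i j‖₊ :=
      Finset.le_sup (f := fun i => ∑ j, ‖N i j‖₊) (Finset.mem_univ i)
    exact_mod_cast h1.trans h2
  have hmap : ∀ j : ℕ, (M ^ j).map Complex.ofReal = M.map Complex.ofReal ^ j := fun j =>
    map_pow (Complex.ofRealHom.mapMatrix) M j
  have hbd : ∀ᶠ j in Filter.atTop, ∀ a b, |(M ^ j) a b| ≤ r ^ j := by
    filter_upwards [hev] with j hj a b
    have h1 := (hentry _ a b).trans hj
    rw [← hmap] at h1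
    simpa using h1
  set t : ℕ → Matrix k k ℝ := fun j => M ^ j * R * (M ^ j)ᵀ with ht
  have hsum : Summable t := by
    refine Pi.summable.mpr fun a => Pi.summable.mpr fun b => ?_
    set K : ℝ := ∑ c, ∑ d, |R d c|
    have hg : Summable fun j : ℕ => K * (r * r) ^ j :=
      (summable_geometric_of_lt_one (by positivity) (by nlinarith)).mul_left _
    refine hg.of_norm_bounded_eventually_nat ?_
    filter_upwards [hbd] with j hj
    simp only [ht, Matrix.mul_apply, transpose_apply, Finset.sum_mul, K]
    refine (norm_sum_le _ _).trans (Finset.sum_le_sum fun c _ => ?_)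
    refine (norm_sum_le _ _).trans (Finset.sum_le_sum fun d _ => ?_)
    rw [Real.norm_eq_abs, abs_mul, abs_mul, mul_pow]
    calc |(M ^ j) a d| * |R d c| * |(M ^ j) b c| ≤ r ^ j * |R d c| * r ^ j := by
          gcongr
          · exact hj a d
          · exact hj b c
      _ = |R d c| * (r ^ j * r ^ j) := by ring
  have hpos : ∀ j, (t j).PosSemidef := fun j => by
    simpa [ht] using hR.mul_mul_conjTranspose_same (M ^ j)
  refine ⟨∑' j, t j, ?_, ?_⟩
  · refine PosSemidef.of_dotProduct_mulVec_nonneg ?_ fun x => ?_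
    · rw [IsHermitian, conjTranspose_eq_transpose_of_trivial, Matrix.transpose_tsum]
      exact tsum_congr fun j => (conjTranspose_eq_transpose_of_trivial _).symm.trans (hpos j).1
    · have hcont : Continuous fun N : Matrix k k ℝ => star x ⬝ᵥ N *ᵥ x := by fun_prop
      have h1 := (hsum.hasSum.map
        (⟨⟨fun N : Matrix k k ℝ => star x ⬝ᵥ N *ᵥ x, by simp⟩, by
          intro a b; simp [add_mulVec, dotProduct_add]⟩ : Matrix k k ℝ →+ ℝ) hcont)
      exact h1.nonneg fun j => (hpos j).dotProduct_mulVec_nonneg x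
  · have h1 : ∀ j, t (j + 1) = M * t j * Mᵀ := fun j => by
      simp only [ht, pow_succ', transpose_mul, Matrix.mul_assoc]
    conv_lhs => rw [hsum.tsum_eq_zero_add]
    simp_rw [h1]
    rw [(hsum.mul_left M).tsum_mul_right, hsum.tsum_mul_left]
    simp [ht]

end DiscreteLyapunov

section ContinuousLyapunov

variable {k q : Type*} [Fintype k] [DecidableEq k] [Fintype q]

/-- On the asymptotically stable part of a Lyapunov stable matrix, cut out by the projection `P`,
the Lyapunov equation has a positive semidefinite solution. -/
theorem exists_posSemidef_lyapunov_solution {A P : Matrix k k ℝ} (E : Matrix k q ℝ)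
    (hA : IsLyapunovStable A) (hAP : A * P = P * A) (hPP : P * P = P)
    (hP0 : ∀ (μ : ℂ) (v : k → ℂ), A.map Complex.ofReal *ᵥ v = μ • v → μ.re = 0 →
      P.map Complex.ofReal *ᵥ v = 0) :
    ∃ S : Matrix k k ℝ, S.PosSemidef ∧ P * S = S ∧
      A * S + S * Aᵀ = -(P * E * (P * E)ᵀ) := by
  have hdet : IsUnit (1 - A) := by
    refine isUnit_of_map_ofReal_mulVec_injective fun v hv => ?_
    by_contra hv0
    rw [map_ofReal_sub, map_ofReal_one, sub_mulVec, one_mulVec, sub_eq_zero] at hv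
    have h1 := (hA 1 ⟨v, hv0, by rw [one_smul, ← hv]⟩).1
    norm_num at h1
  obtain ⟨J, hJl⟩ := hdet.exists_left_inv
  have hJr : (1 - A) * J = 1 := mul_eq_one_comm.mp hJl
  have hPA : P * (1 - A) = (1 - A) * P := by rw [mul_sub, sub_mul, hAP, mul_one, one_mul]
  have hPJ : P * J = J * P := by
    calc P * J = J * (1 - A) * P * J := by rw [hJl, one_mul]
      _ = J * (P * (1 - A)) * J := by rw [hPA]; simp only [mul_assoc]
      _ = J * P * ((1 - A) * J) := by simp only [mul_assoc]
      _ = J * P := by rw [hJr, mul_one]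
  have hPB : P * (J * (1 + A)) = J * (1 + A) * P := by
    rw [← mul_assoc, hPJ, mul_assoc, mul_assoc]
    congr 1
    rw [mul_add, add_mul, hAP, mul_one, one_mul]
  have hC : ∀ (μ : ℂ) (v : k → ℂ), v ≠ 0 →
      (J * (1 + A) * P).map Complex.ofReal *ᵥ v = μ • v → ‖μ‖ < 1 := by
    intro μ v hv hμv
    rcases eq_or_ne μ 0 with rfl | hμ0
    · simp
    have hPv : P.map Complex.ofReal *ᵥ v = v := by
      have h1 := congrArg (P.map Complex.ofReal *ᵥ ·) hμv
      simp only [mulVec_mulVec, mulVec_smul, ← map_ofReal_mul] at h1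
      rw [← mul_assoc, hPB, mul_assoc, hPP, hμv] at h1
      exact (smul_right_injective _ hμ0 h1).symm
    rw [map_ofReal_mul, ← mulVec_mulVec, hPv] at hμv
    have h1 := congrArg ((1 - A).map Complex.ofReal *ᵥ ·) hμv
    simp only [mulVec_mulVec, mulVec_smul, ← map_ofReal_mul] at h1
    rw [← mul_assoc, hJr, one_mul, map_ofReal_add, map_ofReal_sub, map_ofReal_one, add_mulVec,
      sub_mulVec, one_mulVec] at h1
    have h2 : (1 + μ) • (A.map Complex.ofReal *ᵥ v) = (μ - 1) • v := by
      rw [add_smul, sub_smul, one_smul, one_smul]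
      rw [smul_sub] at h1
      linear_combination (exp := 1) h1
    have hμ1 : 1 + μ ≠ 0 := by
      intro h0
      rw [h0, zero_smul] at h2
      have h3 := (smul_eq_zero.mp h2.symm).resolve_right hv
      have : (2 : ℂ) = 0 := by linear_combination h0 - h3
      norm_num at this
    have h3 : A.map Complex.ofReal *ᵥ v = ((μ - 1) / (1 + μ)) • v := by
      rw [div_eq_inv_mul, mul_smul, ← h2, smul_smul, inv_mul_cancel₀ hμ1, one_smul]
    obtain ⟨hle, -⟩ := hA _ ⟨v, hv, h3⟩
    have hlt : ((μ - 1) / (1 + μ)).re < 0 := lt_of_le_of_ne hle fun h0 =>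
      hv (hPv.symm.trans (hP0 _ v h3 h0))
    have hn : 0 < Complex.normSq (1 + μ) := Complex.normSq_pos.mpr hμ1
    rw [Complex.div_re, ← add_div, div_neg_iff] at hlt
    have h4 := hlt.resolve_left fun h => absurd h.2 hn.le.not_gt
    have h5 : Complex.normSq μ < 1 := by
      have := h4.1
      simp only [Complex.sub_re, Complex.add_re, Complex.one_re, Complex.sub_im, Complex.add_im,
        Complex.one_im] at this
      rw [Complex.normSq_apply]
      linarith
    rw [Complex.normSq_eq_norm_sq] at h5
    exact (sq_lt_one_iff₀ (norm_nonneg _)).mp h5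
  obtain ⟨S, hS, hSeq⟩ := exists_posSemidef_stein_solution (J * (1 + A) * P)
    (J * P * E * (J * P * E)ᵀ) hC
    (by simpa using posSemidef_self_mul_conjTranspose (J * P * E))
  have hPS : P * S = S := by
    rw [hSeq, mul_add]
    congr 1
    · simp only [← Matrix.mul_assoc, hPJ]
      rw [mul_assoc J P P, hPP]
    · simp only [← mul_assoc]
      congr 2
      rw [mul_assoc P J, hPB, mul_assoc _ P P, hPP]
  have hST : Sᵀ = S := (conjTranspose_eq_transpose_of_trivial S).symm.trans hS.1
  have hSP : S * Pᵀ = S := by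
    have := congrArg transpose hPS
    rwa [transpose_mul, hST] at this
  have h1 : S = J * P * E * (J * P * E)ᵀ + J * (1 + A) * S * (J * (1 + A))ᵀ := by
    calc S = _ := hSeq
      _ = J * P * E * (J * P * E)ᵀ + J * (1 + A) * (P * S * Pᵀ) * (J * (1 + A))ᵀ := by
        simp only [transpose_mul, mul_assoc]
      _ = _ := by rw [hPS, hSP]
  have h2 : (1 - A) * S * (1 - A)ᵀ =
      P * E * (P * E)ᵀ + (1 + A) * S * (1 + A)ᵀ := by
    have hJT : Jᵀ * (1 - A)ᵀ = 1 := by rw [← transpose_mul, hJr, transpose_one]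
    calc (1 - A) * S * (1 - A)ᵀ
        = (1 - A) * (J * P * E * (J * P * E)ᵀ + J * (1 + A) * S * (J * (1 + A))ᵀ) *
          (1 - A)ᵀ := by rw [← h1]
      _ = ((1 - A) * J) * (P * E * (P * E)ᵀ + (1 + A) * S * (1 + A)ᵀ) *
          (Jᵀ * (1 - A)ᵀ) := by
        generalize 1 + A = D
        simp only [transpose_mul, Matrix.mul_add, Matrix.add_mul, Matrix.mul_assoc]
      _ = _ := by rw [hJr, hJT, one_mul, mul_one]
  have h3 : A * ((2 : ℝ) • S) + ((2 : ℝ) • S) * Aᵀ = -(P * E * (P * E)ᵀ) := by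
    simp only [transpose_sub, transpose_add, transpose_one, sub_mul, mul_sub, add_mul, mul_add,
      one_mul, mul_one] at h2
    rw [Matrix.mul_smul, Matrix.smul_mul, two_smul, two_smul]
    rw [eq_neg_iff_add_eq_zero]
    rw [← sub_eq_zero] at h2
    rw [← neg_eq_zero, ← h2]
    abel
  exact ⟨(2 : ℝ) • S, hS.smul (by norm_num), by rw [Matrix.mul_smul, hPS], h3⟩

/-- The span of the eigenvectors of a Lyapunov stable matrix on the imaginary axis contains the
range of the projection complementary to the stable projection. -/
theorem sub_stable_projection_mem_span {A P : Matrix k k ℝ} (hA : IsLyapunovStable A)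
    (hAP : A * P = P * A) (hPP : P * P = P)
    (hP1 : ∀ (μ : ℂ) (v : k → ℂ), A.map Complex.ofReal *ᵥ v = μ • v → μ.re < 0 →
      P.map Complex.ofReal *ᵥ v = v) (v : k → ℂ) :
    v - P.map Complex.ofReal *ᵥ v ∈ Submodule.span ℂ
      {w | ∃ μ : ℂ, A.map Complex.ofReal *ᵥ w = μ • w ∧ μ.re = 0} := by
  set Ac := A.map Complex.ofReal with hAc
  set Pc := P.map Complex.ofReal with hPc
  set V := Submodule.span ℂ {w : k → ℂ | ∃ μ : ℂ, Ac *ᵥ w = μ • w ∧ μ.re = 0} with hV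
  have hcomm : Ac * Pc = Pc * Ac := by rw [hAc, hPc, ← map_ofReal_mul, hAP, map_ofReal_mul]
  have hidem : Pc * Pc = Pc := by rw [hPc, ← map_ofReal_mul, hPP]
  -- the statement is linear in `v`
  suffices h : (⊤ : Submodule ℂ (k → ℂ)) ≤ V.comap (LinearMap.id - Pc.mulVecLin) from
    h (Submodule.mem_top : v ∈ ⊤)
  rw [← Module.End.iSup_maxGenEigenspace_eq_top Ac.mulVecLin, iSup_le_iff]
  intro μ w hw
  rw [Submodule.mem_comap, LinearMap.sub_apply, LinearMap.id_apply, mulVecLin_apply]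
  set B := Ac - μ • (1 : Matrix k k ℂ) with hB
  have hBP : B * Pc = Pc * B := by
    rw [hB, sub_mul, mul_sub, hcomm, smul_mul_assoc, one_mul, mul_smul_comm, mul_one]
  obtain ⟨j, hj⟩ : ∃ j : ℕ, B ^ j *ᵥ w = 0 := by
    obtain ⟨j, hj⟩ := Module.End.mem_genEigenspace_top.mp hw
    refine ⟨j, ?_⟩
    have h1 : Ac.mulVecLin - μ • (1 : Module.End ℂ (k → ℂ)) = Matrix.toLin' B := by
      ext i; simp [hB]
    rwa [h1, ← Matrix.toLin'_pow, LinearMap.mem_ker, Matrix.toLin'_apply] at hj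
  have heig : ∀ x, B *ᵥ x = 0 ↔ Ac *ᵥ x = μ • x := fun x => by
    rw [hB, sub_mulVec, sub_eq_zero, smul_mulVec, one_mulVec]
  by_cases hre : μ.re < 0
  · have key : ∀ (j : ℕ) (y : k → ℂ), Pc *ᵥ y = 0 → B ^ j *ᵥ y = 0 → y = 0 := by
      intro j
      induction j with
      | zero => intro y _ h; simpa using h
      | succ j ih =>
        intro y hy h
        refine ih y hy ?_
        have h1 : Pc *ᵥ (B ^ j *ᵥ y) = 0 := by
          have h2 : Commute B Pc := hBP
          rw [mulVec_mulVec, ← (h2.pow_left j).eq, ← mulVec_mulVec, hy, mulVec_zero]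
        rw [pow_succ', ← mulVec_mulVec, heig] at h
        rw [← hP1 μ _ h hre, h1]
    have h0 : w - Pc *ᵥ w = 0 := by
      refine key j _ ?_ ?_
      · rw [mulVec_sub, mulVec_mulVec, hidem, sub_self]
      · have h2 : Commute B Pc := hBP
        rw [mulVec_sub, mulVec_mulVec, (h2.pow_left j).eq, ← mulVec_mulVec, hj, mulVec_zero,
          sub_zero]
    rw [h0]
    exact V.zero_mem
  · have key : ∀ (j : ℕ) (y : k → ℂ), B ^ j *ᵥ y = 0 → Ac *ᵥ y = μ • y := by
      intro j
      induction j with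
      | zero => intro y h; simp only [pow_zero, one_mulVec] at h; simp [h]
      | succ j ih =>
        intro y h
        rw [pow_succ, ← mulVec_mulVec] at h
        have h1 := (heig _).mpr (ih _ h)
        by_cases hz : B *ᵥ y = 0
        · exact (heig y).mp hz
        · obtain ⟨hle, hss⟩ := hA μ ⟨_, hz, ih _ h⟩
          exact (heig y).mp (hss (le_antisymm hle (not_lt.mp hre)) y h1)
    have hw1 := key j w hj
    by_cases hw0 : w = 0
    · simp [hw0]
    · obtain ⟨hle, -⟩ := hA μ ⟨w, hw0, hw1⟩
      refine Submodule.subset_span ⟨μ, ?_, le_antisymm hle (not_lt.mp hre)⟩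
      rw [mulVec_sub, mulVec_mulVec, hcomm, ← mulVec_mulVec, hw1, mulVec_smul, smul_sub]

open scoped ComplexOrder in
/-- On the marginally stable part of a Lyapunov stable matrix, cut out by `1 - P`, the homogeneous
Lyapunov equation has a nondegenerate positive semidefinite solution. -/
theorem exists_posSemidef_marginal_solution {A P : Matrix k k ℝ} (hA : IsLyapunovStable A)
    (hAP : A * P = P * A) (hPP : P * P = P)
    (hP0 : ∀ (μ : ℂ) (v : k → ℂ), A.map Complex.ofReal *ᵥ v = μ • v → μ.re = 0 →
      P.map Complex.ofReal *ᵥ v = 0)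
    (hP1 : ∀ (μ : ℂ) (v : k → ℂ), A.map Complex.ofReal *ᵥ v = μ • v → μ.re < 0 →
      P.map Complex.ofReal *ᵥ v = v) :
    ∃ S : Matrix k k ℝ, S.PosSemidef ∧ P * S = 0 ∧ A * S + S * Aᵀ = 0 ∧
      ∀ v : k → ℂ, S.map Complex.ofReal *ᵥ v = 0 → (P.map Complex.ofReal)ᵀ *ᵥ v = v := by
  obtain ⟨b, hbs, hspan, hli⟩ := exists_linearIndependent ℂ
    {w : k → ℂ | ∃ μ : ℂ, A.map Complex.ofReal *ᵥ w = μ • w ∧ μ.re = 0}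
  have : Fintype b := hli.setFinite.fintype
  have hb : ∀ w : b, ∃ μ : ℂ, A.map Complex.ofReal *ᵥ w.1 = μ • w.1 ∧ μ.re = 0 := fun w => hbs w.2
  choose μ hμ hμ0 using hb
  set X : Matrix k b ℝ := of fun i w => (w.1 i).re with hX
  set Z : Matrix k b ℝ := of fun i w => (w.1 i).im with hZ
  set Ω : Matrix b b ℝ := diagonal fun w => (μ w).im with hΩ
  have hre : ∀ (N : Matrix k k ℝ) (w : k → ℂ) i, ((N.map Complex.ofReal *ᵥ w) i).re =
      ∑ j, N i j * (w j).re := fun N w i => by simp [mulVec, dotProduct]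
  have him : ∀ (N : Matrix k k ℝ) (w : k → ℂ) i, ((N.map Complex.ofReal *ᵥ w) i).im =
      ∑ j, N i j * (w j).im := fun N w i => by simp [mulVec, dotProduct]
  have hAX : A * X = -(Z * Ω) := by
    ext i w
    have h1 := congrArg Complex.re (congrFun (hμ w) i)
    rw [hre] at h1
    simp only [Pi.smul_apply, smul_eq_mul, Complex.mul_re, hμ0] at h1
    rw [Matrix.neg_apply, hΩ, mul_diagonal, Matrix.mul_apply]
    simp only [hX, hZ, of_apply, h1]
    ring
  have hAZ : A * Z = X * Ω := by
    ext i w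
    have h1 := congrArg Complex.im (congrFun (hμ w) i)
    rw [him] at h1
    simp only [Pi.smul_apply, smul_eq_mul, Complex.mul_im, hμ0] at h1
    rw [hΩ, mul_diagonal, Matrix.mul_apply]
    simp only [hX, hZ, of_apply, h1]
    ring
  have hPX : P * X = 0 := by
    ext i w
    have h1 := congrArg Complex.re (congrFun (hP0 _ _ (hμ w) (hμ0 w)) i)
    rw [hre] at h1
    simpa [Matrix.mul_apply, hX] using h1
  have hPZ : P * Z = 0 := by
    ext i w
    have h1 := congrArg Complex.im (congrFun (hP0 _ _ (hμ w) (hμ0 w)) i)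
    rw [him] at h1
    simpa [Matrix.mul_apply, hZ] using h1
  have hXX : (X * Xᵀ).PosSemidef := by simpa using posSemidef_self_mul_conjTranspose X
  have hZZ : (Z * Zᵀ).PosSemidef := by simpa using posSemidef_self_mul_conjTranspose Z
  have hker : ∀ (Y : Matrix k b ℝ) (v : k → ℂ),
      star v ⬝ᵥ (Y * Yᵀ).map Complex.ofReal *ᵥ v = 0 → (Y.map Complex.ofReal)ᵀ *ᵥ v = 0 := by
    intro Y v hv
    rw [map_ofReal_mul, map_ofReal_transpose, ← mulVec_mulVec, dotProduct_mulVec,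
      ← conjTranspose_conjTranspose (Y.map _), ← star_mulVec, conjTranspose_conjTranspose,
      conjTranspose_map_ofReal, dotProduct_star_self_eq_zero] at hv
    exact hv
  refine ⟨X * Xᵀ + Z * Zᵀ, hXX.add hZZ, ?_, ?_, fun v hv => ?_⟩
  · rw [Matrix.mul_add, ← Matrix.mul_assoc, ← Matrix.mul_assoc, hPX, hPZ]
    simp
  · have h1 : A * (X * Xᵀ + Z * Zᵀ) = -(Z * Ω * Xᵀ) + X * Ω * Zᵀ := by
      rw [Matrix.mul_add, ← Matrix.mul_assoc, ← Matrix.mul_assoc, hAX, hAZ, Matrix.neg_mul]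
    have h2 : (X * Xᵀ + Z * Zᵀ) * Aᵀ = (A * (X * Xᵀ + Z * Zᵀ))ᵀ := by
      simp [transpose_mul]
    rw [h2, h1]
    simp only [transpose_add, transpose_neg, transpose_mul, transpose_transpose, hΩ,
      diagonal_transpose, Matrix.mul_assoc]
    abel
  · have h0 : star v ⬝ᵥ (X * Xᵀ + Z * Zᵀ).map Complex.ofReal *ᵥ v = 0 := by
      rw [hv, dotProduct_zero]
    rw [map_ofReal_add, add_mulVec, dotProduct_add, add_eq_zero_iff_of_nonneg
      ((posSemidef_map_ofReal hXX).dotProduct_mulVec_nonneg v)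
      ((posSemidef_map_ofReal hZZ).dotProduct_mulVec_nonneg v)] at h0
    have hXv := hker X v h0.1
    have hZv := hker Z v h0.2
    have horth : ∀ u ∈ Submodule.span ℂ b, v ⬝ᵥ u = 0 := by
      intro u hu
      induction hu using Submodule.span_induction with
      | mem w hw =>
        have h1 : v ⬝ᵥ w = ((X.map Complex.ofReal)ᵀ *ᵥ v) ⟨w, hw⟩ +
            Complex.I * ((Z.map Complex.ofReal)ᵀ *ᵥ v) ⟨w, hw⟩ := by
          simp only [mulVec, dotProduct, Finset.mul_sum, ← Finset.sum_add_distrib, hX, hZ,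
            transpose_apply, map_apply, of_apply]
          refine Finset.sum_congr rfl fun i _ => ?_
          nth_rewrite 1 [← Complex.re_add_im (w i)]
          ring
        rw [h1, hXv, hZv]
        simp
      | zero => simp
      | add x y _ _ hx hy => rw [dotProduct_add, hx, hy, add_zero]
      | smul c x _ hx => rw [dotProduct_smul, hx, smul_zero]
    rw [hspan] at horth
    refine (dotProduct_eq _ _ fun u => ?_).symm
    have h1 := horth _ (sub_stable_projection_mem_span hA hAP hPP hP1 u)
    rw [dotProduct_sub, sub_eq_zero] at h1
    rw [h1, dotProduct_mulVec, ← mulVec_transpose]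

open scoped ComplexOrder in
/-- A Lyapunov inequality whose defect is adapted to a controllable pair. -/
theorem exists_posDef_lyapunov_of_isControllablePair {A : Matrix k k ℝ} {E : Matrix k q ℝ}
    (hA : IsLyapunovStable A) (hAE : IsControllablePair A E) :
    ∃ S : Matrix k k ℝ, S.PosDef ∧ (-(A * S + S * Aᵀ)).PosSemidef ∧
      ∀ (μ : ℂ) (v : k → ℂ),
        A.map Complex.ofReal *ᵥ (S.map Complex.ofReal *ᵥ v) = μ • S.map Complex.ofReal *ᵥ v →
        (E.map Complex.ofReal)ᵀ *ᵥ v = 0 → v = 0 := by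
  obtain ⟨P, hAP, hPP, hP0, hP1⟩ := exists_stable_projection hA
  obtain ⟨Ss, hSs, hPSs, hLs⟩ := exists_posSemidef_lyapunov_solution E hA hAP hPP hP0
  obtain ⟨Sc, hSc, hPSc, hLc, hker⟩ := exists_posSemidef_marginal_solution hA hAP hPP hP0 hP1
  have hL : A * (Ss + Sc) + (Ss + Sc) * Aᵀ = -(P * E * (P * E)ᵀ) := by
    rw [← hLs, Matrix.mul_add, Matrix.add_mul, add_add_add_comm, hLc, add_zero]
  have hPS : P * (Ss + Sc) = Ss := by rw [Matrix.mul_add, hPSs, hPSc, add_zero]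
  have hS : (Ss + Sc).PosSemidef := hSs.add hSc
  have hker_sum : ∀ v : k → ℂ, (Ss + Sc).map Complex.ofReal *ᵥ v = 0 →
      Sc.map Complex.ofReal *ᵥ v = 0 := by
    intro v hv
    have h0 : star v ⬝ᵥ (Ss + Sc).map Complex.ofReal *ᵥ v = 0 := by
      rw [hv, dotProduct_zero]
    rw [map_ofReal_add, add_mulVec, dotProduct_add, add_eq_zero_iff_of_nonneg
      ((posSemidef_map_ofReal hSs).dotProduct_mulVec_nonneg v)
      ((posSemidef_map_ofReal hSc).dotProduct_mulVec_nonneg v)] at h0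
    exact ((posSemidef_map_ofReal hSc).dotProduct_mulVec_zero_iff v).mp h0.2
  have hPE : ∀ v : k → ℂ, Sc.map Complex.ofReal *ᵥ v = 0 →
      ((P * E).map Complex.ofReal)ᵀ *ᵥ v = (E.map Complex.ofReal)ᵀ *ᵥ v := by
    intro v hv
    rw [map_ofReal_mul, transpose_mul, ← mulVec_mulVec, hker v hv]
  have hfix : ∀ v : k → ℂ, Ss.map Complex.ofReal *ᵥ v = (Ss + Sc).map Complex.ofReal *ᵥ v →
      Sc.map Complex.ofReal *ᵥ v = 0 := by
    intro v hv
    rwa [map_ofReal_add, add_mulVec, left_eq_add] at hv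
  generalize Ss + Sc = S at hL hPS hS hker_sum hfix
  have hQ : (P * E * (P * E)ᵀ).PosSemidef := by
    simpa using posSemidef_self_mul_conjTranspose (P * E)
  have hQc := posSemidef_map_ofReal hQ
  have hSc' := posSemidef_map_ofReal hS
  have hLv : ∀ v : k → ℂ, A.map Complex.ofReal *ᵥ (S.map Complex.ofReal *ᵥ v) +
      S.map Complex.ofReal *ᵥ ((A.map Complex.ofReal)ᵀ *ᵥ v) =
      -((P * E * (P * E)ᵀ).map Complex.ofReal *ᵥ v) := by
    intro v
    have h1 := congrArg (fun M : Matrix k k ℝ => M.map Complex.ofReal *ᵥ v) hL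
    simpa only [map_ofReal_add, map_ofReal_neg, add_mulVec, neg_mulVec, map_ofReal_mul A,
      map_ofReal_mul S, map_ofReal_transpose, mulVec_mulVec] using h1
  have hstar : ∀ v y : k → ℂ, star v ⬝ᵥ S.map Complex.ofReal *ᵥ y =
      star (S.map Complex.ofReal *ᵥ v) ⬝ᵥ y := by
    intro v y
    rw [dotProduct_mulVec, star_mulVec, hSc'.1.eq]
  have hEQ : ∀ v : k → ℂ, (P * E * (P * E)ᵀ).map Complex.ofReal *ᵥ v = 0 →
      ((P * E).map Complex.ofReal)ᵀ *ᵥ v = 0 := by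
    intro v hv
    have h1 : star v ⬝ᵥ (P * E * (P * E)ᵀ).map Complex.ofReal *ᵥ v = 0 := by
      rw [hv, dotProduct_zero]
    rw [map_ofReal_mul (P * E), map_ofReal_transpose, ← mulVec_mulVec, dotProduct_mulVec,
      ← conjTranspose_conjTranspose ((P * E).map _), ← star_mulVec, conjTranspose_conjTranspose,
      conjTranspose_map_ofReal, dotProduct_star_self_eq_zero] at h1
    exact h1
  have hinj : ∀ v : k → ℂ, S.map Complex.ofReal *ᵥ v = 0 → v = 0 := by
    have hkerQ : ∀ v : k → ℂ, S.map Complex.ofReal *ᵥ v = 0 →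
        (P * E * (P * E)ᵀ).map Complex.ofReal *ᵥ v = 0 := by
      intro v hv
      rw [← hQc.dotProduct_mulVec_zero_iff, ← neg_eq_zero, ← dotProduct_neg, ← hLv, hv,
        mulVec_zero, zero_add, hstar, hv, star_zero, zero_dotProduct]
    by_contra! hne
    obtain ⟨v₀, hv₀, hv₀'⟩ := hne
    set K : Submodule ℂ (k → ℂ) := LinearMap.ker (S.map Complex.ofReal).mulVecLin with hK
    have hKmem : ∀ v, v ∈ K ↔ S.map Complex.ofReal *ᵥ v = 0 := fun v => by
      rw [hK, LinearMap.mem_ker, mulVecLin_apply]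
    have hinv : ∀ v ∈ K, (A.map Complex.ofReal)ᵀ.mulVecLin v ∈ K := by
      intro v hv
      rw [hKmem] at hv ⊢
      have h1 := hLv v
      rw [hkerQ v hv, hv, mulVec_zero, zero_add, neg_zero] at h1
      exact h1
    have : Nontrivial K := ⟨⟨v₀, (hKmem v₀).mpr hv₀⟩, 0, fun h => hv₀' (congrArg Subtype.val h)⟩
    obtain ⟨μ, hμ⟩ := Module.End.exists_eigenvalue ((A.map Complex.ofReal)ᵀ.mulVecLin.restrict hinv)
    obtain ⟨w, hw⟩ := hμ.exists_hasEigenvector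
    have hwK := (hKmem w.1).mp w.2
    refine hAE μ w.1 (fun h => hw.2 (Subtype.ext h)) (congrArg Subtype.val hw.apply_eq_smul) ?_
    rw [← hPE w.1 (hker_sum _ hwK)]
    exact hEQ _ (hkerQ _ hwK)
  refine ⟨S, hS.posDef_iff_isUnit.mpr (isUnit_of_map_ofReal_mulVec_injective hinj),
    by rwa [hL, neg_neg], fun μ v hv hEv => ?_⟩
  by_cases hz : S.map Complex.ofReal *ᵥ v = 0
  · exact hinj v hz
  obtain ⟨hle, -⟩ := hA μ ⟨_, hz, hv⟩
  have hQv : (P * E * (P * E)ᵀ).map Complex.ofReal *ᵥ v = 0 := by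
    rcases hle.lt_or_eq with hlt | h0
    · have h1 := hP1 μ _ hv hlt
      rw [mulVec_mulVec, ← map_ofReal_mul, hPS] at h1
      rw [map_ofReal_mul (P * E), map_ofReal_transpose, ← mulVec_mulVec, hPE v (hfix v h1), hEv,
        mulVec_zero]
    · rw [← hQc.dotProduct_mulVec_zero_iff, ← neg_eq_zero, ← dotProduct_neg, ← hLv,
        dotProduct_add, hv, hstar, dotProduct_mulVec _ (A.map Complex.ofReal)ᵀ,
        ← conjTranspose_map_ofReal, ← star_mulVec, hv, dotProduct_smul, hstar, star_smul,
        smul_dotProduct, ← add_smul]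
      have h1 : μ + star μ = 0 := by
        apply Complex.ext <;> simp [h0]
      rw [h1, zero_smul]
  by_contra hv0
  refine hAE (-μ) v hv0 ?_ hEv
  have h1 := hLv v
  rw [hQv, hv, neg_zero] at h1
  have h2 := hinj ((A.map Complex.ofReal)ᵀ *ᵥ v + μ • v) (by
    rw [mulVec_add, mulVec_smul, add_comm, h1])
  rw [neg_smul]
  exact eq_neg_of_add_eq_zero_left h2

end ContinuousLyapunov

open scoped ComplexOrder in
/-- Lyapunov's criterion for (marginal) stability. -/
theorem isLyapunovStable_of_posDef {k : Type*} [Fintype k] [DecidableEq k] {A S : Matrix k k ℝ}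
    (hS : S.PosDef) (hAS : (-(A * S + S * Aᵀ)).PosSemidef) : IsLyapunovStable A := by
  have hSc := posDef_map_ofReal hS
  have hQc := posSemidef_map_ofReal hAS
  have hLv : ∀ v : k → ℂ, A.map Complex.ofReal *ᵥ (S.map Complex.ofReal *ᵥ v) +
      S.map Complex.ofReal *ᵥ ((A.map Complex.ofReal)ᵀ *ᵥ v) =
      -((-(A * S + S * Aᵀ)).map Complex.ofReal *ᵥ v) := by
    intro v
    rw [map_ofReal_neg, neg_mulVec, neg_neg, map_ofReal_add, add_mulVec, map_ofReal_mul_mulVec,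
      map_ofReal_mul_mulVec, map_ofReal_transpose]
  have hstar : ∀ v y : k → ℂ, star v ⬝ᵥ S.map Complex.ofReal *ᵥ y =
      star (S.map Complex.ofReal *ᵥ v) ⬝ᵥ y := by
    intro v y
    rw [dotProduct_mulVec, star_mulVec, hSc.1.eq]
  have hAstar : ∀ v y : k → ℂ, star v ⬝ᵥ (A.map Complex.ofReal)ᵀ *ᵥ y =
      star (A.map Complex.ofReal *ᵥ v) ⬝ᵥ y := by
    intro v y
    rw [dotProduct_mulVec, ← conjTranspose_map_ofReal, star_mulVec]
  obtain ⟨J, hJ⟩ := hS.isUnit.exists_right_inv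
  have hsurj : ∀ v : k → ℂ, S.map Complex.ofReal *ᵥ (J.map Complex.ofReal *ᵥ v) = v := fun v => by
    rw [← map_ofReal_mul_mulVec, hJ, map_ofReal_one, one_mulVec]
  have hquad : ∀ (μ : ℂ) (y : k → ℂ),
      A.map Complex.ofReal *ᵥ (S.map Complex.ofReal *ᵥ y) = μ • S.map Complex.ofReal *ᵥ y →
      star y ⬝ᵥ (-(A * S + S * Aᵀ)).map Complex.ofReal *ᵥ y =
        -((2 * μ.re : ℝ) * (star y ⬝ᵥ S.map Complex.ofReal *ᵥ y)) := by
    intro μ y hy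
    rw [← neg_inj, neg_neg, ← dotProduct_neg, ← hLv, dotProduct_add, hy, hstar y (_ *ᵥ y), hAstar,
      hy, dotProduct_smul, star_smul, smul_dotProduct, hstar, ← add_smul, smul_eq_mul]
    congr 1
    apply Complex.ext <;> simp [two_mul]
  rintro μ ⟨v, hv, hμv⟩
  have hre : μ.re ≤ 0 := by
    have h1 := hquad μ (J.map Complex.ofReal *ᵥ v) (by rw [hsurj, hμv])
    have h2 := hSc.dotProduct_mulVec_pos (x := J.map Complex.ofReal *ᵥ v) fun h0 => hv (by
      rw [← hsurj v, h0, mulVec_zero])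
    have h3 := hQc.dotProduct_mulVec_nonneg (J.map Complex.ofReal *ᵥ v)
    rw [h1, Complex.nonneg_iff, Complex.neg_re, Complex.re_ofReal_mul] at h3
    have h4 := (Complex.pos_iff.mp h2).1
    nlinarith [h3.1]
  refine ⟨hre, fun h0 u hu => ?_⟩
  set w := (A.map Complex.ofReal - μ • (1 : Matrix k k ℂ)) *ᵥ u with hw
  have hAw : A.map Complex.ofReal *ᵥ w = μ • w := by
    rwa [sub_mulVec, sub_eq_zero, smul_mulVec, one_mulVec] at hu
  obtain ⟨y, hy⟩ : ∃ y, S.map Complex.ofReal *ᵥ y = w := ⟨_, hsurj w⟩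
  have hQy : (-(A * S + S * Aᵀ)).map Complex.ofReal *ᵥ y = 0 := by
    rw [← hQc.dotProduct_mulVec_zero_iff, hquad μ y (by rw [hy, hAw]), h0]
    simp
  have h1 := hLv y
  rw [hQy, hy, hAw, neg_zero, ← hy, ← mulVec_smul, ← mulVec_add] at h1
  have h2 : (A.map Complex.ofReal)ᵀ *ᵥ y = -μ • y := by
    rw [neg_smul]
    exact eq_neg_of_add_eq_zero_right (map_ofReal_mulVec_injective hS.isUnit h1)
  have h3 : star y ⬝ᵥ S.map Complex.ofReal *ᵥ y = 0 := by
    rw [hy, hw, sub_mulVec, smul_mulVec, one_mulVec, dotProduct_sub, dotProduct_mulVec,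
      ← conjTranspose_conjTranspose (A.map _), ← star_mulVec, conjTranspose_map_ofReal, h2,
      star_smul, smul_dotProduct, dotProduct_smul, ← sub_smul]
    have h4 : star (-μ) - μ = 0 := by
      apply Complex.ext <;> simp [h0]
    rw [h4, zero_smul]
  rw [← hy]
  exact (hSc.posSemidef.dotProduct_mulVec_zero_iff y).mp h3

/-- Controllability is inherited by the original system from a state feedback transform. -/
theorem IsControllablePair.of_feedback {k q r : Type*} [Fintype k] [Fintype q] [Fintype r]
    {A : Matrix k k ℝ} {B : Matrix k q ℝ} (K : Matrix q k ℝ) (L : Matrix q r ℝ)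
    (h : IsControllablePair (A + B * K) (B * L)) : IsControllablePair A B := by
  intro μ v hv hμ hB
  refine h μ v hv ?_ ?_
  · rw [map_ofReal_add, map_ofReal_mul, transpose_add, transpose_mul, add_mulVec,
      ← mulVec_mulVec, hB, mulVec_zero, add_zero, hμ]
  · rw [map_ofReal_mul, transpose_mul, ← mulVec_mulVec, hB, mulVec_zero]

/-- Controllability passes to a row compression of the system. -/
theorem IsControllablePair.of_compression {k l q r : Type*} [Fintype k] [Fintype l] [Fintype q]
    [Fintype r] [DecidableEq l] {A : Matrix k k ℝ} {B : Matrix k q ℝ} {F : Matrix l l ℝ}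
    {E : Matrix l r ℝ} (W : Matrix l k ℝ) (V : Matrix k l ℝ) (U : Matrix r k ℝ)
    (h : IsControllablePair A B) (hWV : W * V = 1) (hWB : W * B = 0)
    (hWA : W * A = F * W + F * E * U) : IsControllablePair F E := by
  intro μ v hv hμ hE
  have hcomp : ∀ {s : Type _} [Fintype s] (X : Matrix l k ℝ) (Y : Matrix k s ℝ),
      (Y.map Complex.ofReal)ᵀ *ᵥ ((X.map Complex.ofReal)ᵀ *ᵥ v) =
        ((X * Y).map Complex.ofReal)ᵀ *ᵥ v := by
    intro s _ X Y
    rw [map_ofReal_mul, transpose_mul, mulVec_mulVec]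
  refine h μ ((W.map Complex.ofReal)ᵀ *ᵥ v) (fun h0 => hv ?_) ?_ ?_
  · have h1 := hcomp W V
    rw [h0, mulVec_zero, hWV, map_ofReal_one, transpose_one, one_mulVec] at h1
    exact h1.symm
  · rw [mulVec_mulVec, ← transpose_mul, ← map_ofReal_mul, hWA, map_ofReal_add, map_ofReal_mul,
      map_ofReal_mul, map_ofReal_mul, transpose_add, transpose_mul, transpose_mul, transpose_mul,
      add_mulVec, ← mulVec_mulVec, ← mulVec_mulVec, ← mulVec_mulVec, hμ, mulVec_smul, mulVec_smul,
      hE, smul_zero, mulVec_zero, add_zero]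
  · rw [mulVec_mulVec, ← transpose_mul, ← map_ofReal_mul, hWB, map_ofReal_zero, transpose_zero,
      zero_mulVec]

/-- A positive semidefinite matrix annihilates every matrix on which its form vanishes. -/
theorem PosSemidef.mul_transpose_eq_zero {k l : Type*} [Fintype k] [Fintype l]
    [DecidableEq l] {D : Matrix k k ℝ} (hD : D.PosSemidef) {U : Matrix l k ℝ} (h : U * D * Uᵀ = 0) :
    D * Uᵀ = 0 := by
  apply Matrix.ext_of_mulVec_single
  intro i
  rw [zero_mulVec, ← mulVec_mulVec, ← hD.dotProduct_mulVec_zero_iff, star_trivial,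
    mulVec_transpose U, ← dotProduct_mulVec, ← mulVec_transpose, mulVec_mulVec,
    mulVec_mulVec, h, zero_mulVec, dotProduct_zero]

theorem vecMul_injective_of_mul_eq_one {k l : Type*} [Fintype k] [Fintype l] [DecidableEq l]
    {U : Matrix l k ℝ} {V : Matrix k l ℝ} (h : U * V = 1) : Function.Injective U.vecMul := by
  intro x y hxy
  have := congrArg (V.vecMul ·) hxy
  simpa [h] using this

section NormalForm

variable {m p n : Type*} [Fintype m] [Fintype p] [Fintype n] [DecidableEq m] [DecidableEq p]

/-- The zero dynamics of a system of relative degree two satisfying the conditions of the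
negative imaginary lemma are Lyapunov stable. -/
theorem isLyapunovStable_zero_dynamics {A Y : Matrix n n ℝ} {B : Matrix n p ℝ}
    {U₁ : Matrix m n ℝ} {U₂ : Matrix p n ℝ} {V₁ : Matrix n m ℝ} {V₂ : Matrix n p ℝ}
    {A₁₁ : Matrix m m ℝ} {A₁₂ A₁₃ : Matrix m p ℝ}
    (h₁₁ : U₁ * V₁ = 1) (h₂₁ : U₂ * V₁ = 0) (h₂₂ : U₂ * V₂ = 1)
    (hB₁ : U₁ * B = 0) (hB₂ : U₂ * B = 0)
    (hA : U₁ * A = A₁₁ * U₁ + A₁₂ * U₂ + A₁₃ * (U₂ * A))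
    (hY : Y.PosDef) (hAY : (-(A * Y + Y * Aᵀ)).PosSemidef) (hBY : B + A * Y * U₂ᵀ = 0) :
    IsLyapunovStable A₁₁ := by
  have hYt : Yᵀ = Y := (conjTranspose_eq_transpose_of_trivial Y).symm.trans hY.1
  have h1 : U₁ * (A * (Y * U₂ᵀ)) = 0 := by
    have := congrArg (U₁ * ·) hBY
    simpa [Matrix.mul_add, hB₁, Matrix.mul_assoc] using this
  have h2 : U₂ * (A * (Y * U₂ᵀ)) = 0 := by
    have := congrArg (U₂ * ·) hBY
    simpa [Matrix.mul_add, hB₂, Matrix.mul_assoc] using this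
  have h2' : U₂ * (Y * (Aᵀ * U₂ᵀ)) = 0 := by
    have := congrArg transpose h2
    simpa [hYt, Matrix.mul_assoc] using this
  have hD := PosSemidef.mul_transpose_eq_zero hAY (U := U₂) (by
    simp only [Matrix.mul_neg, Matrix.neg_mul, Matrix.mul_add, Matrix.add_mul, Matrix.mul_assoc,
      h2, h2', add_zero, neg_zero])
  have h3' : U₁ * (Y * (Aᵀ * U₂ᵀ)) = 0 := by
    have := congrArg (U₁ * ·) hD
    simpa [Matrix.add_mul, Matrix.mul_add, Matrix.mul_assoc, h1] using this
  have h3 : U₂ * (A * (Y * U₁ᵀ)) = 0 := by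
    have := congrArg transpose h3'
    simpa [hYt, Matrix.mul_assoc] using this
  have hY₂ : (U₂ * Y * U₂ᵀ).PosDef := by
    have := hY.mul_mul_conjTranspose_same (B := U₂) (vecMul_injective_of_mul_eq_one h₂₂)
    rwa [conjTranspose_eq_transpose_of_trivial] at this
  obtain ⟨J, hJ⟩ := hY₂.isUnit.exists_left_inv
  obtain ⟨L, hL⟩ : ∃ L, L = U₁ - U₁ * Y * U₂ᵀ * J * U₂ := ⟨_, rfl⟩
  have hLY : L * (Y * U₂ᵀ) = 0 := by
    have h4 : J * (U₂ * (Y * U₂ᵀ)) = 1 := by rw [← Matrix.mul_assoc U₂, hJ]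
    simp only [hL, Matrix.sub_mul, Matrix.mul_assoc, h4, Matrix.mul_one, sub_self]
  have hLY' : U₂ * (Y * Lᵀ) = 0 := by
    have := congrArg transpose hLY
    simpa [hYt, Matrix.mul_assoc] using this
  have hLV : L * V₁ = 1 := by
    simp [hL, Matrix.sub_mul, Matrix.mul_assoc, h₁₁, h₂₁]
  have hS : (L * Y * Lᵀ).PosDef := by
    have := hY.mul_mul_conjTranspose_same (B := L) (vecMul_injective_of_mul_eq_one hLV)
    rwa [conjTranspose_eq_transpose_of_trivial] at this
  have hAL : U₂ * (A * (Y * Lᵀ)) = 0 := by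
    have h4 : Lᵀ = U₁ᵀ - U₂ᵀ * (U₁ * Y * U₂ᵀ * J)ᵀ := by rw [hL, transpose_sub, transpose_mul]
    simp only [← Matrix.mul_assoc] at h2 h3 ⊢
    rw [h4, Matrix.mul_sub, h3, ← Matrix.mul_assoc, h2, Matrix.zero_mul, sub_zero]
  have hLX : ∀ X : Matrix n m ℝ, U₂ * X = 0 → L * X = U₁ * X := by
    intro X hX
    rw [hL, Matrix.sub_mul, Matrix.mul_assoc _ U₂, hX, Matrix.mul_zero, sub_zero]
  have hLA : L * (A * (Y * Lᵀ)) = A₁₁ * (L * (Y * Lᵀ)) := by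
    rw [hLX _ hAL, hLX _ hLY', ← Matrix.mul_assoc U₁, hA]
    simp only [Matrix.add_mul, Matrix.mul_assoc, hLY', hAL, Matrix.mul_zero, add_zero]
  refine isLyapunovStable_of_posDef hS ?_
  have hfin := hAY.mul_mul_conjTranspose_same L
  have hLA' : L * (Y * (Aᵀ * Lᵀ)) = L * (Y * Lᵀ) * A₁₁ᵀ := by
    have := congrArg transpose hLA
    simpa [hYt, Matrix.mul_assoc] using this
  convert hfin using 1
  rw [conjTranspose_eq_transpose_of_trivial]
  simp only [Matrix.mul_neg, Matrix.neg_mul, Matrix.mul_add, Matrix.add_mul, Matrix.mul_assoc,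
      hLA, hLA']

theorem mul_mul_of_mul_eq {a b c d : Type*} [Fintype b] [Fintype c] {U : Matrix a b ℝ}
    {V : Matrix b c ℝ} {Z : Matrix a c ℝ} (X : Matrix c d ℝ) (h : U * V = Z) :
    U * (V * X) = Z * X := by
  rw [← Matrix.mul_assoc, h]

/-- A left factor of a real square matrix with trivial complex kernel has nonzero determinant. -/
theorem det_ne_zero_of_mul_mulVec_injective {k : Type*} [Fintype k] [DecidableEq k]
    {A Y : Matrix k k ℝ} (h : ∀ v : k → ℂ, (A * Y).map Complex.ofReal *ᵥ v = 0 → v = 0) :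
    A.det ≠ 0 := by
  have h1 := (isUnit_iff_isUnit_det _).mp (isUnit_of_map_ofReal_mulVec_injective h)
  rw [det_mul] at h1
  exact (isUnit_of_mul_isUnit_left h1).ne_zero

/-- A system of relative degree two in normal form with Lyapunov stable, controllable zero dynamics
can be assigned a feedback gain satisfying the conditions of the negative imaginary lemma. -/
theorem exists_gain_negative_imaginary [DecidableEq n]
    {U₁ : Matrix m n ℝ} {U₂ U₃ : Matrix p n ℝ} {V₁ : Matrix n m ℝ} {V₂ V₃ : Matrix n p ℝ}
    {A₁₁ : Matrix m m ℝ} {A₁₂ A₁₃ M : Matrix m p ℝ}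
    (h₁₁ : U₁ * V₁ = 1) (h₁₂ : U₁ * V₂ = 0) (h₁₃ : U₁ * V₃ = 0)
    (h₂₁ : U₂ * V₁ = 0) (h₂₂ : U₂ * V₂ = 1) (h₂₃ : U₂ * V₃ = 0)
    (h₃₁ : U₃ * V₁ = 0) (h₃₂ : U₃ * V₂ = 0) (h₃₃ : U₃ * V₃ = 1)
    (hone : V₁ * U₁ + V₂ * U₂ + V₃ * U₃ = 1)
    (hdet : IsUnit A₁₁) (hM : A₁₁ * M = -A₁₂)
    (hst : IsLyapunovStable A₁₁) (hc : IsControllablePair A₁₁ (A₁₃ - M)) :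
    ∃ (F : Matrix p n ℝ), ∀ A : Matrix n n ℝ,
      U₁ * A = A₁₁ * U₁ + A₁₂ * U₂ + A₁₃ * U₃ → U₂ * A = U₃ → U₃ * A = F →
      IsObservablePair A U₂ ∧ A.det ≠ 0 ∧
      ∃ Y : Matrix n n ℝ, Y.PosDef ∧ (-(A * Y + Y * Aᵀ)).PosSemidef ∧ V₃ + A * Y * U₂ᵀ = 0 := by
  obtain ⟨S, hS, hSA, hSc⟩ := exists_posDef_lyapunov_of_isControllablePair hst hc
  have hSt : Sᵀ = S := (conjTranspose_eq_transpose_of_trivial S).symm.trans hS.1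
  obtain ⟨W, hW⟩ : ∃ W, W = V₁ * M + V₂ := ⟨_, rfl⟩
  obtain ⟨Y, hY⟩ : ∃ Y, Y = V₁ * S * V₁ᵀ + W * Wᵀ + V₃ * V₃ᵀ := ⟨_, rfl⟩
  have hYt : Yᵀ = Y := by
    simp [hY, hSt, Matrix.mul_assoc]
  have hUY₁ : U₁ * Y = S * V₁ᵀ + M * Wᵀ := by
    have : U₁ * W = M := by simp [hW, Matrix.mul_add, mul_mul_of_mul_eq M h₁₁, h₁₂]
    simp [hY, Matrix.mul_add, Matrix.mul_assoc, mul_mul_of_mul_eq _ h₁₁,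
      mul_mul_of_mul_eq _ h₁₃, mul_mul_of_mul_eq _ this]
  have hUY₂ : U₂ * Y = Wᵀ := by
    have : U₂ * W = 1 := by simp [hW, Matrix.mul_add, mul_mul_of_mul_eq M h₂₁, h₂₂]
    simp [hY, Matrix.mul_add, Matrix.mul_assoc, mul_mul_of_mul_eq _ h₂₁,
      mul_mul_of_mul_eq _ h₂₃, mul_mul_of_mul_eq _ this]
  have hUY₃ : U₃ * Y = V₃ᵀ := by
    have : U₃ * W = 0 := by simp [hW, Matrix.mul_add, mul_mul_of_mul_eq M h₃₁, h₃₂]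
    simp [hY, Matrix.mul_add, Matrix.mul_assoc, mul_mul_of_mul_eq _ h₃₁,
      mul_mul_of_mul_eq _ h₃₃, mul_mul_of_mul_eq _ this]
  have hker : ∀ v : n → ℂ, V₁ᵀ.map Complex.ofReal *ᵥ v = 0 → V₂ᵀ.map Complex.ofReal *ᵥ v = 0 →
      V₃ᵀ.map Complex.ofReal *ᵥ v = 0 → v = 0 := by
    intro v h1 h2 h3
    have hone' : U₁ᵀ * V₁ᵀ + U₂ᵀ * V₂ᵀ + U₃ᵀ * V₃ᵀ = 1 := by
      rw [← transpose_one, ← hone]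
      simp
    rw [← one_mulVec v, ← map_ofReal_one, ← hone', map_ofReal_add, map_ofReal_add, add_mulVec,
      add_mulVec, map_ofReal_mul_mulVec, map_ofReal_mul_mulVec, map_ofReal_mul_mulVec, h1, h2, h3]
    simp
  have hWv : ∀ v : n → ℂ, Wᵀ.map Complex.ofReal *ᵥ v =
      Mᵀ.map Complex.ofReal *ᵥ (V₁ᵀ.map Complex.ofReal *ᵥ v) + V₂ᵀ.map Complex.ofReal *ᵥ v := by
    intro v
    rw [hW, transpose_add, transpose_mul, map_ofReal_add, add_mulVec, map_ofReal_mul_mulVec]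
  have hYP : Y.PosDef := by
    have h1 : Y.PosSemidef := by
      rw [hY]
      have := hS.posSemidef.mul_mul_conjTranspose_same V₁
      rw [conjTranspose_eq_transpose_of_trivial] at this
      exact (this.add (by simpa using posSemidef_self_mul_conjTranspose W)).add
        (by simpa using posSemidef_self_mul_conjTranspose V₃)
    rw [h1.posDef_iff_isUnit]
    refine isUnit_of_map_ofReal_mulVec_injective fun v hv => ?_
    have hw : Wᵀ.map Complex.ofReal *ᵥ v = 0 := by
      rw [← hUY₂, map_ofReal_mul_mulVec, hv, mulVec_zero]
    have hv3 : V₃ᵀ.map Complex.ofReal *ᵥ v = 0 := by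
      rw [← hUY₃, map_ofReal_mul_mulVec, hv, mulVec_zero]
    have hv1 : V₁ᵀ.map Complex.ofReal *ᵥ v = 0 := by
      refine map_ofReal_mulVec_injective hS.isUnit ?_
      have : (U₁ * Y).map Complex.ofReal *ᵥ v = 0 := by
        rw [map_ofReal_mul_mulVec, hv, mulVec_zero]
      rwa [hUY₁, map_ofReal_add, add_mulVec, map_ofReal_mul_mulVec, map_ofReal_mul_mulVec, hw,
        mulVec_zero, add_zero] at this
    refine hker v hv1 ?_ hv3
    rwa [hWv, hv1, mulVec_zero, zero_add] at hw
  obtain ⟨J, hJ⟩ := hYP.isUnit.exists_left_inv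
  have hJ' : Y * J = 1 := mul_eq_one_comm.mp hJ
  refine ⟨-(V₂ + V₁ * A₁₃)ᵀ * J, fun A hA₁ hA₂ hA₃ => ?_⟩
  have hAY₁ : U₁ * (A * Y) = A₁₁ * S * V₁ᵀ + A₁₃ * V₃ᵀ := by
    rw [← Matrix.mul_assoc, hA₁]
    simp only [Matrix.add_mul, Matrix.mul_assoc, hUY₁, hUY₂, hUY₃, Matrix.mul_add,
      mul_mul_of_mul_eq _ hM, Matrix.neg_mul]
    abel
  have hAY₂ : U₂ * (A * Y) = V₃ᵀ := by rw [← Matrix.mul_assoc, hA₂, hUY₃]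
  have hAY₃ : U₃ * (A * Y) = -(V₂ + V₁ * A₁₃)ᵀ := by
    rw [← Matrix.mul_assoc, hA₃, Matrix.mul_assoc, hJ, Matrix.mul_one]
  have hAY : A * Y = V₁ * (A₁₁ * S * V₁ᵀ + A₁₃ * V₃ᵀ) + V₂ * V₃ᵀ - V₃ * (V₂ + V₁ * A₁₃)ᵀ := by
    rw [← Matrix.one_mul (A * Y), ← hone, Matrix.add_mul, Matrix.add_mul, Matrix.mul_assoc,
      Matrix.mul_assoc, Matrix.mul_assoc, hAY₁, hAY₂, hAY₃, Matrix.mul_neg, sub_eq_add_neg]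
  refine ⟨?_, ?_, Y, hYP, ?_, ?_⟩
  · intro μ v hv hμ hv2
    apply hv
    have hv3 : U₃.map Complex.ofReal *ᵥ v = 0 := by
      rw [← hA₂, map_ofReal_mul_mulVec, hμ, mulVec_smul, hv2, smul_zero]
    obtain ⟨y, hy⟩ : ∃ y, Y.map Complex.ofReal *ᵥ y = v :=
      ⟨J.map Complex.ofReal *ᵥ v, by
        rw [← map_ofReal_mul_mulVec, hJ', map_ofReal_one, one_mulVec]⟩
    have hy3 : V₃ᵀ.map Complex.ofReal *ᵥ y = 0 := by
      rw [← hUY₃, map_ofReal_mul_mulVec, hy, hv3]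
    have hyW : Wᵀ.map Complex.ofReal *ᵥ y = 0 := by
      rw [← hUY₂, map_ofReal_mul_mulVec, hy, hv2]
    have hyF : (V₂ + V₁ * A₁₃)ᵀ.map Complex.ofReal *ᵥ y = 0 := by
      rw [← neg_eq_zero, ← neg_mulVec, ← map_ofReal_neg, ← hAY₃, map_ofReal_mul_mulVec,
        map_ofReal_mul_mulVec, hy, hμ, mulVec_smul, hv3, smul_zero]
    have hz : U₁.map Complex.ofReal *ᵥ v =
        S.map Complex.ofReal *ᵥ (V₁ᵀ.map Complex.ofReal *ᵥ y) := by
      rw [← hy, ← map_ofReal_mul_mulVec, hUY₁, map_ofReal_add, add_mulVec, map_ofReal_mul_mulVec,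
        map_ofReal_mul_mulVec, hyW, mulVec_zero, add_zero]
    have hq : V₁ᵀ.map Complex.ofReal *ᵥ y = 0 := by
      refine hSc μ _ ?_ ?_
      · have : (U₁ * A).map Complex.ofReal *ᵥ v = μ • U₁.map Complex.ofReal *ᵥ v := by
          rw [map_ofReal_mul_mulVec, hμ, mulVec_smul]
        rwa [hA₁, map_ofReal_add, map_ofReal_add, add_mulVec, add_mulVec, map_ofReal_mul_mulVec,
          map_ofReal_mul_mulVec, map_ofReal_mul_mulVec, hv2, hv3, mulVec_zero, mulVec_zero,
          add_zero, add_zero, hz] at this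
      · rw [hWv] at hyW
        rw [transpose_add, transpose_mul, map_ofReal_add, add_mulVec, map_ofReal_mul_mulVec,
          add_comm] at hyF
        rw [← map_ofReal_transpose, transpose_sub, map_ofReal_sub, sub_mulVec, sub_eq_zero]
        exact add_right_cancel (hyF.trans hyW.symm)
    rw [hq, mulVec_zero] at hz
    rw [← one_mulVec v, ← map_ofReal_one, ← hone, map_ofReal_add, map_ofReal_add, add_mulVec,
      add_mulVec, map_ofReal_mul_mulVec, map_ofReal_mul_mulVec, map_ofReal_mul_mulVec, hz, hv2, hv3]
    simp
  · refine det_ne_zero_of_mul_mulVec_injective (Y := Y) fun y hy => ?_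
    have hy3 : V₃ᵀ.map Complex.ofReal *ᵥ y = 0 := by
      rw [← hAY₂, map_ofReal_mul_mulVec, hy, mulVec_zero]
    have hyF : (V₂ + V₁ * A₁₃)ᵀ.map Complex.ofReal *ᵥ y = 0 := by
      rw [← neg_eq_zero, ← neg_mulVec, ← map_ofReal_neg, ← hAY₃, map_ofReal_mul_mulVec, hy,
        mulVec_zero]
    have hy1 : V₁ᵀ.map Complex.ofReal *ᵥ y = 0 := by
      refine map_ofReal_mulVec_injective (hdet.mul hS.isUnit) ?_
      have : (U₁ * (A * Y)).map Complex.ofReal *ᵥ y = 0 := by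
        rw [map_ofReal_mul_mulVec, hy, mulVec_zero]
      rwa [hAY₁, map_ofReal_add, add_mulVec, map_ofReal_mul_mulVec, map_ofReal_mul_mulVec A₁₃, hy3,
        mulVec_zero, add_zero] at this
    refine hker y hy1 ?_ hy3
    rwa [transpose_add, transpose_mul, map_ofReal_add, add_mulVec, map_ofReal_mul_mulVec, hy1,
      mulVec_zero, add_zero] at hyF
  · have h1 : Y * Aᵀ = (A * Y)ᵀ := by rw [transpose_mul, hYt]
    have h2 := hSA.mul_mul_conjTranspose_same V₁
    convert h2 using 1
    rw [h1, hAY, conjTranspose_eq_transpose_of_trivial]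
    simp only [transpose_add, transpose_sub, transpose_mul, transpose_transpose, hSt,
      Matrix.mul_add, Matrix.add_mul, Matrix.mul_assoc, Matrix.mul_neg, Matrix.neg_mul]
    abel
  · have h1 : A * Y * U₂ᵀ = (U₂ * (A * Y)ᵀ)ᵀ := by rw [transpose_mul, transpose_transpose]
    rw [h1, hAY]
    simp only [transpose_add, transpose_sub, transpose_mul, transpose_transpose, hSt,
      Matrix.mul_add, Matrix.mul_assoc, Matrix.mul_sub, mul_mul_of_mul_eq _ h₂₁,
      mul_mul_of_mul_eq _ h₂₃, mul_mul_of_mul_eq _ h₂₂, Matrix.zero_mul, Matrix.one_mul]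
    simp

/-- Coordinate form of the equivalence: `V₁`, `V₂`, `V₃` are the column blocks of the inverse of the
matrix with row blocks `U₁`, `C`, `C * A`. -/
theorem negative_imaginary_feedback_iff [DecidableEq n] {A : Matrix n n ℝ} {B : Matrix n p ℝ}
    {C : Matrix p n ℝ} {U₁ : Matrix m n ℝ} {V₁ : Matrix n m ℝ} {V₂ V₃ : Matrix n p ℝ}
    (hCB : C * B = 0) (hG : (C * A * B).det ≠ 0) (hUB : U₁ * B = 0)
    (h₁₁ : U₁ * V₁ = 1) (h₁₂ : U₁ * V₂ = 0) (h₁₃ : U₁ * V₃ = 0)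
    (h₂₁ : C * V₁ = 0) (h₂₂ : C * V₂ = 1) (h₂₃ : C * V₃ = 0)
    (h₃₁ : C * A * V₁ = 0) (h₃₂ : C * A * V₂ = 0) (h₃₃ : C * A * V₃ = 1)
    (hone : V₁ * U₁ + V₂ * C + V₃ * (C * A) = 1) (hdet : (U₁ * A * V₁).det ≠ 0) :
    (∃ (Kx : Matrix p n ℝ) (Kv : Matrix p p ℝ), IsUnit Kv.det ∧
      IsControllablePair (A + B * Kx) (B * Kv) ∧ IsObservablePair (A + B * Kx) C ∧
      (A + B * Kx).det ≠ 0 ∧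
      ∃ Y : Matrix n n ℝ, Y.PosDef ∧ (-((A + B * Kx) * Y + Y * (A + B * Kx)ᵀ)).PosSemidef ∧
        B * Kv + (A + B * Kx) * Y * Cᵀ = 0) ↔
    (IsControllablePair A B ∧ IsLyapunovStable (U₁ * A * V₁)) := by
  have hUA : U₁ * A = U₁ * A * V₁ * U₁ + U₁ * A * V₂ * C + U₁ * A * V₃ * (C * A) := by
    conv_lhs => rw [← Matrix.mul_one (U₁ * A), ← hone]
    simp only [Matrix.mul_add, Matrix.mul_assoc]
  have hUK : ∀ K : Matrix p n ℝ, U₁ * (A + B * K) = U₁ * A := fun K => by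
    rw [Matrix.mul_add, mul_mul_of_mul_eq K hUB, Matrix.zero_mul, add_zero]
  have hCK : ∀ K : Matrix p n ℝ, C * (A + B * K) = C * A := fun K => by
    rw [Matrix.mul_add, mul_mul_of_mul_eq K hCB, Matrix.zero_mul, add_zero]
  constructor
  · rintro ⟨Kx, Kv, -, hc, -, -, Y, hY, hAY, hBY⟩
    refine ⟨hc.of_feedback, isLyapunovStable_zero_dynamics (B := B * Kv)
      (A₁₂ := U₁ * A * V₂) (A₁₃ := U₁ * A * V₃) h₁₁ h₂₁ h₂₂ ?_ ?_ ?_ hY hAY hBY⟩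
    · rw [mul_mul_of_mul_eq Kv hUB, Matrix.zero_mul]
    · rw [mul_mul_of_mul_eq Kv hCB, Matrix.zero_mul]
    · rw [hUK, hCK]
      exact hUA
  · rintro ⟨hc, hst⟩
    have hdet' : IsUnit (U₁ * A * V₁).det := isUnit_iff_ne_zero.mpr hdet
    obtain ⟨M, hM⟩ : ∃ M, U₁ * A * V₁ * M = -(U₁ * A * V₂) :=
      ⟨(U₁ * A * V₁)⁻¹ * -(U₁ * A * V₂), mul_nonsing_inv_cancel_left _ _ hdet'⟩
    have hE : IsControllablePair (U₁ * A * V₁) (U₁ * A * V₃ - M) := by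
      refine hc.of_compression (U₁ - U₁ * A * V₃ * C) V₁ C ?_ ?_ ?_
      · rw [Matrix.sub_mul, Matrix.mul_assoc _ C, h₂₁, Matrix.mul_zero, sub_zero, h₁₁]
      · rw [Matrix.sub_mul, Matrix.mul_assoc _ C, hCB, Matrix.mul_zero, sub_zero, hUB]
      · rw [Matrix.sub_mul, Matrix.mul_sub (U₁ * A * V₁) _ M, hM, Matrix.mul_assoc _ C]
        refine (congrArg (· - U₁ * A * V₃ * (C * A)) hUA).trans ?_
        simp only [Matrix.mul_sub, Matrix.mul_assoc, Matrix.sub_mul, Matrix.neg_mul]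
        abel
    obtain ⟨F, hF⟩ := exists_gain_negative_imaginary h₁₁ h₁₂ h₁₃ h₂₁ h₂₂ h₂₃ h₃₁ h₃₂ h₃₃ hone
      ((isUnit_iff_isUnit_det _).mpr hdet') hM hst hE
    have hG' : IsUnit (C * A * B).det := isUnit_iff_ne_zero.mpr hG
    obtain ⟨ho, hd, Y, hY, hAY, hBY⟩ := hF (A + B * ((C * A * B)⁻¹ * (F - C * A * A)))
      (by rw [hUK]; exact hUA) (hCK _) (by
        rw [Matrix.mul_add, ← Matrix.mul_assoc _ B, mul_nonsing_inv_cancel_left _ _ hG',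
          add_sub_cancel])
    have hBV : B * (C * A * B)⁻¹ = V₃ := by
      have h1 : B = V₃ * (C * A * B) := by
        conv_lhs => rw [← Matrix.one_mul B, ← hone]
        simp only [Matrix.add_mul, Matrix.mul_assoc, hUB, hCB, Matrix.mul_zero, zero_add]
      refine (congrArg (· * (C * A * B)⁻¹) h1).trans ?_
      exact mul_nonsing_inv_cancel_right _ _ hG'
    refine ⟨_, (C * A * B)⁻¹, isUnit_nonsing_inv_det _ hG', ?_, ho, hd, Y, hY, hAY, ?_⟩
    · refine IsControllablePair.of_feedback (-(C * A * B * ((C * A * B)⁻¹ * (F - C * A * A))))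
        (C * A * B) ?_
      rw [Matrix.mul_neg, Matrix.mul_assoc B, nonsing_inv_mul_cancel_left _ _ hG',
        add_neg_cancel_right, Matrix.mul_assoc B, nonsing_inv_mul _ hG', Matrix.mul_one]
      exact hc
    · rw [hBV]
      exact hBY

end NormalForm

/-- Main theorem, relative degree two case: a system `(𝒜, ℬ, 𝒞)` of relative degree two
with no zero at the origin is state feedback equivalent (`u = K_x x + K_v v`) to a minimal
NI system iff it is controllable and weakly minimum phase (the zero dynamics matrix `A11`
is Lyapunov stable). -/
theorem main_NI_state_feedback_equivalence_relative_degree_two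
    (n p : ℕ) (h2p : 2 * p ≤ n)
    (𝒜 : Matrix (Fin n) (Fin n) ℝ) (ℬ : Matrix (Fin n) (Fin p) ℝ)
    (𝒞 : Matrix (Fin p) (Fin n) ℝ)
    (hCB : 𝒞 * ℬ = 0) (hCAB : (𝒞 * 𝒜 * ℬ).det ≠ 0)
    (𝒞z : Matrix (Fin (n - 2 * p)) (Fin n) ℝ) (h𝒞z : 𝒞z * ℬ = 0)
    (T : Matrix (Fin n) (Fin n) ℝ)
    (hTdef : T = (Matrix.fromRows 𝒞z (Matrix.fromRows 𝒞 (𝒞 * 𝒜))).submatrix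
      ((((Equiv.refl (Fin (n - 2 * p))).sumCongr finSumFinEquiv).trans
        (finSumFinEquiv.trans (finCongr (show n - 2 * p + (p + p) = n by omega)))).symm) id)
    (hT : IsUnit T)
    (A11 : Matrix (Fin (n - 2 * p)) (Fin (n - 2 * p)) ℝ)
    (hA11def : A11 = ((T * 𝒜 * T⁻¹).submatrix
      (⇑(((Equiv.refl (Fin (n - 2 * p))).sumCongr finSumFinEquiv).trans
        (finSumFinEquiv.trans (finCongr (show n - 2 * p + (p + p) = n by omega)))))
      (⇑(((Equiv.refl (Fin (n - 2 * p))).sumCongr finSumFinEquiv).trans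
        (finSumFinEquiv.trans (finCongr (show n - 2 * p + (p + p) = n by omega)))))).toBlocks₁₁)
    (hA11 : A11.det ≠ 0) :
    (∃ (Kx : Matrix (Fin p) (Fin n) ℝ) (Kv : Matrix (Fin p) (Fin p) ℝ),
      IsUnit Kv.det ∧
      IsControllablePair (𝒜 + ℬ * Kx) (ℬ * Kv) ∧
      IsObservablePair (𝒜 + ℬ * Kx) 𝒞 ∧
      (𝒜 + ℬ * Kx).det ≠ 0 ∧
      ∃ Y : Matrix (Fin n) (Fin n) ℝ, Y.PosDef ∧
        (-((𝒜 + ℬ * Kx) * Y + Y * (𝒜 + ℬ * Kx)ᵀ)).PosSemidef ∧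
        ℬ * Kv + (𝒜 + ℬ * Kx) * Y * 𝒞ᵀ = 0) ↔
    (IsControllablePair 𝒜 ℬ ∧ IsLyapunovStable A11) := by
  obtain ⟨e, he⟩ : ∃ e, e = ((Equiv.refl (Fin (n - 2 * p))).sumCongr finSumFinEquiv).trans
    (finSumFinEquiv.trans (finCongr (show n - 2 * p + (p + p) = n by omega))) := ⟨_, rfl⟩
  rw [← he] at hTdef hA11def
  have hT' : IsUnit T.det := (isUnit_iff_isUnit_det _).mp hT
  obtain ⟨U, hU⟩ : ∃ U, U = fromRows 𝒞z (fromRows 𝒞 (𝒞 * 𝒜)) := ⟨_, rfl⟩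
  rw [← hU] at hTdef
  have hUT : U = T.submatrix e id := by rw [hTdef]; ext; simp
  obtain ⟨V₁, V₂, V₃, hV⟩ : ∃ V₁ V₂ V₃, fromCols V₁ (fromCols V₂ V₃) = T⁻¹.submatrix id e :=
    ⟨(T⁻¹.submatrix id e).toCols₁, (T⁻¹.submatrix id e).toCols₂.toCols₁,
      (T⁻¹.submatrix id e).toCols₂.toCols₂, by simp⟩
  have hUV : U * fromCols V₁ (fromCols V₂ V₃) = 1 := by
    rw [hV, hUT, ← submatrix_mul _ _ e id e Function.bijective_id, mul_nonsing_inv _ hT',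
      submatrix_one_equiv]
  have hVU : fromCols V₁ (fromCols V₂ V₃) * U = 1 := by
    rw [hV, hUT, ← submatrix_mul _ _ id e id e.bijective, nonsing_inv_mul _ hT', submatrix_id_id]
  have hA : A11 = 𝒞z * 𝒜 * V₁ := by
    have : (T * 𝒜 * T⁻¹).submatrix e e = U * 𝒜 * fromCols V₁ (fromCols V₂ V₃) := by
      rw [hV, hUT, submatrix_mul _ _ e id e Function.bijective_id,
        submatrix_mul _ _ e id id Function.bijective_id, submatrix_id_id]
    rw [hA11def, this, hU, fromRows_mul, fromRows_mul_fromCols, toBlocks_fromBlocks₁₁]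
  rw [hU, fromRows_mul_fromCols, ← fromBlocks_one, fromBlocks_inj, mul_fromCols, fromRows_mul,
    fromRows_mul_fromCols, ← fromBlocks_one, fromBlocks_inj, ← fromCols_zero, fromCols_ext_iff,
    ← fromRows_zero, fromRows_ext_iff] at hUV
  rw [hU, fromCols_mul_fromRows, fromCols_mul_fromRows, ← add_assoc] at hVU
  obtain ⟨h₁₁, ⟨h₁₂, h₁₃⟩, ⟨h₂₁, h₃₁⟩, h₂₂, h₂₃, h₃₂, h₃₃⟩ := hUV
  rw [hA] at hA11 ⊢
  exact negative_imaginary_feedback_iff hCB hCAB h𝒞z h₁₁ h₁₂ h₁₃ h₂₁ h₂₂ h₂₃ h₃₁ h₃₂ h₃₃ hVU hA11
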